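/- arXiv:2411.09561 — 3 statements merged into one kernel-verified Lean document; each statement's English description precedes it below -/
import Mathlib

section
/- For every choice of the real parameters ζ₁₁, ζ₂₂, ζ₃₃, ζ₁₂, ζ₁₃, ζ₂₃, the tensor h⁺ is divergence-free: for each i ∈ {1,2,3,4} and every x ∈ ℝ⁴∖{0}, ∑_{k=1}^4 ∂_k(h⁺_{ki})(x) = 0. -/
open scoped BigOperators

noncomputable section

/-- Partial derivative in the `i`-th coordinate direction. -/
def pd {n : ℕ} (i : Fin n) (f : (Fin n → ℝ) → ℝ) : (Fin n → ℝ) → ℝ :=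
  fun x => fderiv ℝ f x (Pi.single i 1)

/-- The complex structure `I₁` on `ℝ⁴`. -/
def I1 : Matrix (Fin 4) (Fin 4) ℝ :=
  !![0, -1, 0, 0; 1, 0, 0, 0; 0, 0, 0, -1; 0, 0, 1, 0]

/-- The complex structure `I₂` on `ℝ⁴`. -/
def I2 : Matrix (Fin 4) (Fin 4) ℝ :=
  !![0, 0, -1, 0; 0, 0, 0, 1; 1, 0, 0, 0; 0, -1, 0, 0]

/-- The complex structure `I₃ = I₁ I₂` on `ℝ⁴`. -/
def I3 : Matrix (Fin 4) (Fin 4) ℝ := I1 * I2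

/-- `α_J(x) = Jᵀ x`. -/
def alphaVec (J : Matrix (Fin 4) (Fin 4) ℝ) (x : Fin 4 → ℝ) : Fin 4 → ℝ :=
  Matrix.mulVec (Matrix.transpose J) x

/-- The outer product `A_{JK}(x) = α_J(x) · α_K(x)ᵀ`. -/
def Amat (J K : Matrix (Fin 4) (Fin 4) ℝ) (x : Fin 4 → ℝ) : Matrix (Fin 4) (Fin 4) ℝ :=
  Matrix.vecMulVec (alphaVec J x) (alphaVec K x)

/-- The leading term `h⁺` of the expansion of an ALE metric,
`h⁺(x) = −(2/(3 r⁶)) · [ζ₁₁(2A₁₁−A₂₂−A₃₃) + ζ₂₂(2A₂₂−A₁₁−A₃₃) + ζ₃₃(2A₃₃−A₁₁−A₂₂)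
          + ζ₁₂(A₁₂+A₂₁) + ζ₁₃(A₁₃+A₃₁) + ζ₂₃(A₂₃+A₃₂)]`. -/
def hplus (ζ11 ζ22 ζ33 ζ12 ζ13 ζ23 : ℝ) (x : Fin 4 → ℝ) : Matrix (Fin 4) (Fin 4) ℝ :=
  (-(2 / (3 * (∑ i, x i ^ 2) ^ 3))) •
    (ζ11 • ((2 : ℝ) • Amat I1 I1 x - Amat I2 I2 x - Amat I3 I3 x) +
     ζ22 • ((2 : ℝ) • Amat I2 I2 x - Amat I1 I1 x - Amat I3 I3 x) +
     ζ33 • ((2 : ℝ) • Amat I3 I3 x - Amat I1 I1 x - Amat I2 I2 x) +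
     ζ12 • (Amat I1 I2 x + Amat I2 I1 x) +
     ζ13 • (Amat I1 I3 x + Amat I3 I1 x) +
     ζ23 • (Amat I2 I3 x + Amat I3 I2 x))

/-- Coordinate `a` of `α_J` as a continuous linear functional. -/
def alphaCLM (J : Matrix (Fin 4) (Fin 4) ℝ) (a : Fin 4) : (Fin 4 → ℝ) →L[ℝ] ℝ :=
  LinearMap.toContinuousLinearMap
    ((LinearMap.proj a).comp (Matrix.mulVecLin (Matrix.transpose J)))

lemma alphaCLM_apply (J : Matrix (Fin 4) (Fin 4) ℝ) (a : Fin 4) (x : Fin 4 → ℝ) :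
    alphaCLM J a x = alphaVec J x a := rfl

lemma hasFDerivAt_Amat (J K : Matrix (Fin 4) (Fin 4) ℝ) (a b : Fin 4) (x : Fin 4 → ℝ) :
    HasFDerivAt (fun y => Amat J K y a b)
      (alphaVec J x a • alphaCLM K b + alphaVec K x b • alphaCLM J a) x :=
  (alphaCLM J a).hasFDerivAt.mul (alphaCLM K b).hasFDerivAt

lemma hasFDerivAt_sq (x : Fin 4 → ℝ) :
    HasFDerivAt (fun y : Fin 4 → ℝ => ∑ i, y i ^ 2)
      (∑ i, (2 * x i) • (ContinuousLinearMap.proj i : (Fin 4 → ℝ) →L[ℝ] ℝ)) x := by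
  refine HasFDerivAt.fun_sum fun i _ => ?_
  simpa using (hasFDerivAt_apply (𝕜 := ℝ) i x).pow 2

lemma hasFDerivAt_factor (x : Fin 4 → ℝ) (hs : (∑ i, x i ^ 2) ≠ 0) :
    HasFDerivAt (fun y : Fin 4 → ℝ => -(2 / (3 * (∑ i, y i ^ 2) ^ 3)))
      ((2 / (∑ i, x i ^ 2) ^ 4) •
        ∑ i, (2 * x i) • (ContinuousLinearMap.proj i : (Fin 4 → ℝ) →L[ℝ] ℝ)) x := by
  have h : HasDerivAt (fun s : ℝ => -(2 / (3 * s ^ 3))) (2 / (∑ i, x i ^ 2) ^ 4)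
      (∑ i, x i ^ 2) := by
    generalize (∑ i, x i ^ 2) = s at hs
    have h1 := ((hasDerivAt_const s (2 : ℝ)).div
      ((hasDerivAt_pow 3 s).const_mul 3) (by positivity)).neg
    refine h1.congr_deriv ?_
    field_simp
    norm_num
    ring
  have h2 := HasDerivAt.comp_hasFDerivAt (f := fun y : Fin 4 → ℝ => ∑ i, y i ^ 2) x h
    (hasFDerivAt_sq x)
  exact h2

/-- `h⁺` is divergence-free on `ℝ⁴ ∖ {0}`: `∑ₖ ∂ₖ (h⁺)ₖᵢ = 0` for each `i`. -/
theorem hplus_divergenceFree (ζ11 ζ22 ζ33 ζ12 ζ13 ζ23 : ℝ) (i : Fin 4)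
    (x : Fin 4 → ℝ) (hx : x ≠ 0) :
    ∑ k, pd k (fun y => hplus ζ11 ζ22 ζ33 ζ12 ζ13 ζ23 y k i) x = 0 := by
  have hs : (∑ i, x i ^ 2) ≠ 0 := by
    intro h
    apply hx
    funext j
    have := (Finset.sum_eq_zero_iff_of_nonneg (fun i _ => sq_nonneg (x i))).1 h j
      (Finset.mem_univ j)
    simpa using this
  have key : ∀ k, HasFDerivAt (fun y => hplus ζ11 ζ22 ζ33 ζ12 ζ13 ζ23 y k i) _ x := fun k =>
    (hasFDerivAt_factor x hs).mul
      (((((((((hasFDerivAt_Amat I1 I1 k i x).const_mul 2).sub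
          (hasFDerivAt_Amat I2 I2 k i x)).sub (hasFDerivAt_Amat I3 I3 k i x)).const_mul ζ11).add
        (((((hasFDerivAt_Amat I2 I2 k i x).const_mul 2).sub
          (hasFDerivAt_Amat I1 I1 k i x)).sub (hasFDerivAt_Amat I3 I3 k i x)).const_mul ζ22)).add
        (((((hasFDerivAt_Amat I3 I3 k i x).const_mul 2).sub
          (hasFDerivAt_Amat I1 I1 k i x)).sub (hasFDerivAt_Amat I2 I2 k i x)).const_mul ζ33)).add
        (((hasFDerivAt_Amat I1 I2 k i x).add (hasFDerivAt_Amat I2 I1 k i x)).const_mul ζ12)).add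
        (((hasFDerivAt_Amat I1 I3 k i x).add (hasFDerivAt_Amat I3 I1 k i x)).const_mul ζ13)
        |>.add
        (((hasFDerivAt_Amat I2 I3 k i x).add (hasFDerivAt_Amat I3 I2 k i x)).const_mul ζ23))
  have hI3 : I3 = !![0, 0, 0, -1; 0, 0, -1, 0; 0, 1, 0, 0; 1, 0, 0, 0] := by
    ext a b
    fin_cases a <;> fin_cases b <;> simp [I3, I1, I2, Matrix.mul_apply, Fin.sum_univ_four]
  simp only [pd, (key _).fderiv]
  generalize hS : (∑ i, x i ^ 2) = s at *
  clear key hS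
  fin_cases i <;>
  · simp [Fin.sum_univ_four, alphaCLM_apply, alphaVec, Amat, Matrix.vecMulVec_apply, hI3, I1, I2,
      Matrix.mulVec, dotProduct, Pi.single_apply]
    field_simp
    ring
end
end

section
/- With σ₁, σ₂, σ₃, σ₄ the explicit integrals defined below, one has 8·(3σ₁ + 6σ₂ + 6σ₃ + σ₄) = 2π². -/
open scoped BigOperators
open MeasureTheory

noncomputable section

/-- `σ₁ = ∫_{[−1,1]³} y₁⁴/(1+|y|²)⁴ dy`. -/
def sigma1 : ℝ :=
  ∫ y in Set.Icc (fun _ : Fin 3 => (-1 : ℝ)) (fun _ => 1),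
    (y 0) ^ 4 / (1 + ∑ i, (y i) ^ 2) ^ 4

/-- `σ₂ = ∫_{[−1,1]³} y₁²y₂²/(1+|y|²)⁴ dy`. -/
def sigma2 : ℝ :=
  ∫ y in Set.Icc (fun _ : Fin 3 => (-1 : ℝ)) (fun _ => 1),
    (y 0) ^ 2 * (y 1) ^ 2 / (1 + ∑ i, (y i) ^ 2) ^ 4

/-- `σ₃ = ∫_{[−1,1]³} y₁²/(1+|y|²)⁴ dy`. -/
def sigma3 : ℝ :=
  ∫ y in Set.Icc (fun _ : Fin 3 => (-1 : ℝ)) (fun _ => 1),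
    (y 0) ^ 2 / (1 + ∑ i, (y i) ^ 2) ^ 4

/-- `σ₄ = ∫_{[−1,1]³} 1/(1+|y|²)⁴ dy`. -/
def sigma4 : ℝ :=
  ∫ y in Set.Icc (fun _ : Fin 3 => (-1 : ℝ)) (fun _ => 1),
    1 / (1 + ∑ i, (y i) ^ 2) ^ 4

/-- The cube `[-1,1]³`. -/
def cubeSet : Set (Fin 3 → ℝ) := Set.Icc (fun _ : Fin 3 => (-1 : ℝ)) (fun _ => 1)

lemma cube_perm (e : Equiv.Perm (Fin 3)) (f : (Fin 3 → ℝ) → ℝ) :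
    ∫ y in cubeSet, f (fun i => y (e i)) = ∫ y in cubeSet, f y := by
  have h := (volume_preserving_arrowCongr' e.symm (MeasurableEquiv.refl ℝ)
    (MeasurePreserving.id volume)).setIntegral_preimage_emb
    (MeasurableEquiv.measurableEmbedding _) f cubeSet
  rw [← h]
  have hs : (MeasurableEquiv.arrowCongr' e.symm (MeasurableEquiv.refl ℝ)) ⁻¹' cubeSet
      = cubeSet := by
    ext y
    simp only [cubeSet, Set.mem_preimage, Set.mem_Icc, Pi.le_def]
    constructor
    · rintro ⟨h1, h2⟩
      refine ⟨fun i => ?_, fun i => ?_⟩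
      · have := h1 (e.symm i)
        change _ ≤ y (e (e.symm i)) at this
        simpa using this
      · have := h2 (e.symm i)
        change y (e (e.symm i)) ≤ _ at this
        simpa using this
    · rintro ⟨h1, h2⟩
      exact ⟨fun i => h1 (e i), fun i => h2 (e i)⟩
  rw [hs]
  rfl

lemma cube_integrable (f : (Fin 3 → ℝ) → ℝ) (hf : Continuous f) :
    IntegrableOn f cubeSet :=
  hf.continuousOn.integrableOn_compact isCompact_Icc

lemma denom_pos (y : Fin 3 → ℝ) : 0 < 1 + ∑ i, (y i) ^ 2 := by positivity

lemma cube_restrict : (volume : Measure (Fin 3 → ℝ)).restrict cubeSet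
    = Measure.pi (fun _ : Fin 3 => (volume : Measure ℝ).restrict (Set.Icc (-1) 1)) := by
  rw [cubeSet, ← Set.pi_univ_Icc, volume_pi, Measure.restrict_pi_pi]

lemma cube_gauss (t : ℝ) : ∫ y in cubeSet, Real.exp (-t ^ 2 * ∑ i, (y i) ^ 2)
    = (∫ x in (-1 : ℝ)..1, Real.exp (-(t * x) ^ 2)) ^ 3 := by
  have h : ∀ y : Fin 3 → ℝ, Real.exp (-t ^ 2 * ∑ i, (y i) ^ 2)
      = ∏ i, Real.exp (-(t * y i) ^ 2) := by
    intro y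
    rw [← Real.exp_sum, Finset.mul_sum]
    congr 1
    refine Finset.sum_congr rfl fun i _ => ?_
    ring
  simp_rw [h]
  rw [cube_restrict, integral_fintype_prod_eq_pow (fun x : ℝ => Real.exp (-(t * x) ^ 2)),
    intervalIntegral.integral_of_le (by norm_num), integral_Icc_eq_integral_Ioc]
  simp

/-- The truncated Gaussian integral. -/
def gaussG (t : ℝ) : ℝ := ∫ x in (-t)..t, Real.exp (-x ^ 2)

lemma gaussG_eq (t : ℝ) : t * ∫ x in (-1 : ℝ)..1, Real.exp (-(t * x) ^ 2) = gaussG t := by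
  have := intervalIntegral.mul_integral_comp_mul_left (a := -1) (b := 1)
    (f := fun x => Real.exp (-x ^ 2)) (c := t)
  simpa [gaussG] using this

lemma gaussG_deriv (t : ℝ) : HasDerivAt gaussG (2 * Real.exp (-t ^ 2)) t := by
  have hc : Continuous (fun x : ℝ => Real.exp (-x ^ 2)) := by fun_prop
  have hF : ∀ s, HasDerivAt (fun u => ∫ x in (0 : ℝ)..u, Real.exp (-x ^ 2))
      (Real.exp (-s ^ 2)) s := fun s =>
    intervalIntegral.integral_hasDerivAt_right (hc.intervalIntegrable _ _)
      (hc.stronglyMeasurableAtFilter _ _) hc.continuousAt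
  have hG : gaussG = fun u => (∫ x in (0 : ℝ)..u, Real.exp (-x ^ 2))
      - ∫ x in (0 : ℝ)..(-u), Real.exp (-x ^ 2) := by
    funext u
    rw [gaussG, intervalIntegral.integral_interval_sub_left (hc.intervalIntegrable _ _)
      (hc.intervalIntegrable _ _)]
  rw [hG]
  have h2 := (hF (-t)).comp t (hasDerivAt_neg t)
  have h3 := (hF t).sub h2
  have h4 : Real.exp (-t ^ 2) - Real.exp (-(-t) ^ 2) * -1 = 2 * Real.exp (-t ^ 2) := by
    rw [neg_sq]; ring
  rw [h4] at h3
  exact h3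

lemma gaussG_tendsto : Filter.Tendsto gaussG Filter.atTop (nhds (Real.sqrt Real.pi)) := by
  have h1 := integral_gaussian 1
  have h2 := integrable_exp_neg_mul_sq (b := 1) one_pos
  have := intervalIntegral_tendsto_integral h2 Filter.tendsto_neg_atTop_atBot
    (Filter.tendsto_id (α := ℝ) (x := Filter.atTop))
  rw [h1] at this
  have h3 : gaussG = fun t => ∫ x in (-t)..t, Real.exp (-x ^ 2) := rfl
  rw [h3]
  simpa using this

lemma gauss_total : ∫ t in Set.Ioi (0 : ℝ), gaussG t ^ 3 * Real.exp (-t ^ 2)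
    = Real.pi ^ 2 / 8 := by
  have hlim : Filter.Tendsto (fun t => gaussG t ^ 4 / 8) Filter.atTop
      (nhds (Real.sqrt Real.pi ^ 4 / 8)) := (gaussG_tendsto.pow 4).div_const 8
  rw [integral_Ioi_of_hasDerivAt_of_nonneg' (g := fun t => gaussG t ^ 4 / 8) _ _ hlim]
  · have : Real.sqrt Real.pi ^ 4 = Real.pi ^ 2 := by
      rw [show (4 : ℕ) = 2 * 2 from rfl, pow_mul, Real.sq_sqrt Real.pi_pos.le]
    simp [this, gaussG]
  · intro x _
    have h3 := ((gaussG_deriv x).pow 4).div_const 8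
    have h4 : ((4 : ℕ) : ℝ) * gaussG x ^ (4 - 1) * (2 * Real.exp (-x ^ 2)) / 8
        = gaussG x ^ 3 * Real.exp (-x ^ 2) := by
      push_cast
      ring
    rw [h4] at h3
    exact h3
  · intro x hx
    have : 0 ≤ gaussG x :=
      intervalIntegral.integral_nonneg (by linarith [Set.mem_Ioi.1 hx])
        fun u _ => (Real.exp_pos _).le
    positivity

lemma radial_integral (b : ℝ) (hb : 0 < b) :
    ∫ t in Set.Ioi (0 : ℝ), t ^ 3 * Real.exp (-b * t ^ 2) = 1 / (2 * b ^ 2) := by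
  have h := integral_rpow_mul_exp_neg_mul_rpow (p := 2) (q := 3) (b := b)
    (by norm_num) (by norm_num) hb
  have h2 : (-(3 + 1) / 2 : ℝ) = -((2 : ℕ) : ℝ) := by norm_num
  have h3 : ((3 + 1) / 2 : ℝ) = 2 := by norm_num
  rw [h2, h3, Real.Gamma_two, Real.rpow_neg hb.le, Real.rpow_natCast] at h
  have h4 : ∀ t : ℝ, t ^ (3 : ℝ) = t ^ 3 := fun t => by exact_mod_cast Real.rpow_natCast t 3
  have h5 : ∀ t : ℝ, t ^ (2 : ℝ) = t ^ 2 := fun t => by exact_mod_cast Real.rpow_natCast t 2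
  simp only [h4, h5] at h
  rw [h]
  field_simp

lemma radial_integrable :
    IntegrableOn (fun t : ℝ => t ^ 3 * Real.exp (-t ^ 2)) (Set.Ioi 0) := by
  have h := integrableOn_rpow_mul_exp_neg_mul_sq (b := 1) one_pos (s := 3) (by norm_num)
  have h4 : ∀ t : ℝ, t ^ (3 : ℝ) = t ^ 3 := fun t => by exact_mod_cast Real.rpow_natCast t 3
  simpa [h4] using h

lemma cube_main : ∫ y in cubeSet, 1 / (1 + ∑ i, (y i) ^ 2) ^ 2 = Real.pi ^ 2 / 4 := by
  have hint : Integrable (Function.uncurry fun (t : ℝ) (y : Fin 3 → ℝ) =>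
      t ^ 3 * Real.exp (-(1 + ∑ i, (y i) ^ 2) * t ^ 2))
      ((volume.restrict (Set.Ioi (0 : ℝ))).prod (volume.restrict cubeSet)) := by
    have h1 : Integrable (fun _ : Fin 3 → ℝ => (1 : ℝ)) (volume.restrict cubeSet) :=
      cube_integrable _ continuous_const
    refine (Integrable.mul_prod radial_integrable h1).mono ?_ ?_
    · apply Continuous.aestronglyMeasurable
      unfold Function.uncurry
      fun_prop
    · refine Filter.Eventually.of_forall fun z => ?_
      simp only [Function.uncurry, norm_mul, Real.norm_eq_abs, Real.abs_exp, mul_one]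
      gcongr
      have : 0 ≤ ∑ i, (z.2 i) ^ 2 := by positivity
      nlinarith [mul_nonneg this (sq_nonneg z.1)]
  have hswap := integral_integral_swap hint
  have hL : ∀ t : ℝ, ∫ y in cubeSet, t ^ 3 * Real.exp (-(1 + ∑ i, (y i) ^ 2) * t ^ 2)
      = gaussG t ^ 3 * Real.exp (-t ^ 2) := by
    intro t
    rw [← gaussG_eq, mul_pow, ← cube_gauss, mul_assoc, ← integral_mul_const,
      ← integral_const_mul]
    congr 1
    funext y
    rw [← Real.exp_add]
    congr 2
    ring
  simp_rw [hL, radial_integral _ (denom_pos _)] at hswap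
  rw [gauss_total] at hswap
  have : ∀ y : Fin 3 → ℝ, 1 / (2 * (1 + ∑ i, (y i) ^ 2) ^ 2)
      = (1 / 2) * (1 / (1 + ∑ i, (y i) ^ 2) ^ 2) := by
    intro y
    have := denom_pos y
    field_simp
  simp_rw [this] at hswap
  rw [integral_const_mul] at hswap
  linarith

/-- A numerator divided by the common denominator. -/
def quot4 (p : (Fin 3 → ℝ) → ℝ) (y : Fin 3 → ℝ) : ℝ := p y / (1 + ∑ i, (y i) ^ 2) ^ 4

lemma quot4_perm (e : Equiv.Perm (Fin 3)) (p : (Fin 3 → ℝ) → ℝ) :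
    ∫ y in cubeSet, quot4 (fun y => p (fun i => y (e i))) y = ∫ y in cubeSet, quot4 p y := by
  rw [← cube_perm e (quot4 p)]
  congr 1
  funext y
  simp only [quot4]
  rw [Equiv.sum_comp e (fun i => y i ^ 2)]

lemma quot4_int (p : (Fin 3 → ℝ) → ℝ) (hp : Continuous p) :
    Integrable (quot4 p) (volume.restrict cubeSet) := by
  apply cube_integrable
  unfold quot4
  exact hp.div (by fun_prop) fun y => ne_of_gt (pow_pos (denom_pos y) 4)

/-- `8(3σ₁ + 6σ₂ + 6σ₃ + σ₄) = 2π²`. -/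
theorem sigma_sum_eq : 8 * (3 * sigma1 + 6 * sigma2 + 6 * sigma3 + sigma4) = 2 * Real.pi ^ 2 := by
  have s1 : sigma1 = ∫ y in cubeSet, quot4 (fun y => y 0 ^ 4) y := rfl
  have s2 : sigma2 = ∫ y in cubeSet, quot4 (fun y => y 0 ^ 2 * y 1 ^ 2) y := rfl
  have s3 : sigma3 = ∫ y in cubeSet, quot4 (fun y => y 0 ^ 2) y := rfl
  have s4 : sigma4 = ∫ y in cubeSet, quot4 (fun _ => 1) y := rfl
  have a1 : ∫ y in cubeSet, quot4 (fun y => y 1 ^ 4) y = sigma1 := by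
    rw [s1]; exact quot4_perm (Equiv.swap 0 1) (fun y => y 0 ^ 4)
  have a2 : ∫ y in cubeSet, quot4 (fun y => y 2 ^ 4) y = sigma1 := by
    rw [s1]; exact quot4_perm (Equiv.swap 0 2) (fun y => y 0 ^ 4)
  have b1 : ∫ y in cubeSet, quot4 (fun y => y 2 ^ 2 * y 1 ^ 2) y = sigma2 := by
    rw [s2]; exact quot4_perm (Equiv.swap 0 2) (fun y => y 0 ^ 2 * y 1 ^ 2)
  have b2 : ∫ y in cubeSet, quot4 (fun y => y 0 ^ 2 * y 2 ^ 2) y = sigma2 := by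
    rw [s2]; exact quot4_perm (Equiv.swap 1 2) (fun y => y 0 ^ 2 * y 1 ^ 2)
  have c1 : ∫ y in cubeSet, quot4 (fun y => y 1 ^ 2) y = sigma3 := by
    rw [s3]; exact quot4_perm (Equiv.swap 0 1) (fun y => y 0 ^ 2)
  have c2 : ∫ y in cubeSet, quot4 (fun y => y 2 ^ 2) y = sigma3 := by
    rw [s3]; exact quot4_perm (Equiv.swap 0 2) (fun y => y 0 ^ 2)
  have hadd : ∀ p q : (Fin 3 → ℝ) → ℝ, Continuous p → Continuous q →
      ∫ y in cubeSet, quot4 (fun y => p y + q y) y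
        = (∫ y in cubeSet, quot4 p y) + ∫ y in cubeSet, quot4 q y := by
    intro p q hp hq
    rw [← integral_add (quot4_int p hp) (quot4_int q hq)]
    congr 1
    funext y
    simp only [quot4, add_div]
  have hmul : ∀ (c : ℝ) (p : (Fin 3 → ℝ) → ℝ),
      ∫ y in cubeSet, quot4 (fun y => c * p y) y = c * ∫ y in cubeSet, quot4 p y := by
    intro c p
    rw [← integral_const_mul]
    congr 1
    funext y
    simp only [quot4, mul_div_assoc]
  have hm : ∫ y in cubeSet, 1 / (1 + ∑ i, (y i) ^ 2) ^ 2
      = ∫ y in cubeSet, quot4 (fun y => (y 0 ^ 4 + (y 1 ^ 4 + y 2 ^ 4)) +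
        (2 * (y 0 ^ 2 * y 1 ^ 2 + (y 2 ^ 2 * y 1 ^ 2 + y 0 ^ 2 * y 2 ^ 2)) +
        (2 * (y 0 ^ 2 + (y 1 ^ 2 + y 2 ^ 2)) + 1))) y := by
    congr 1
    funext y
    have := denom_pos y
    rw [quot4, div_eq_div_iff (by positivity) (by positivity)]
    simp only [Fin.sum_univ_three]
    ring
  rw [cube_main] at hm
  rw [hadd _ _ (by fun_prop) (by fun_prop), hadd _ _ (by fun_prop) (by fun_prop),
    hadd _ _ (by fun_prop) (by fun_prop), hadd _ _ (by fun_prop) (by fun_prop),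
    hmul, hadd _ _ (by fun_prop) (by fun_prop), hadd _ _ (by fun_prop) (by fun_prop),
    hadd _ _ (by fun_prop) (by fun_prop),
    hmul, hadd _ _ (by fun_prop) (by fun_prop), hadd _ _ (by fun_prop) (by fun_prop),
    a1, a2, b1, b2, c1, c2, ← s1, ← s2, ← s3, ← s4] at hm
  linarith
end
end

section
/- For every choice of the real parameters ζ₁₁, ζ₂₂, ζ₃₃, ζ₁₂, ζ₁₃, ζ₂₃, ξ₁₁, ξ₂₂, ξ₃₃, ξ₁₂, ξ₁₃, ξ₂₃ and for each i ∈ {1,...,4}, the cube-boundary integral ∑_{j=1}^4 ∫_{[−1,1]³} [ F_{ij}(x)|_{x^j=1} − F_{ij}(x)|_{x^j=−1} ] dx̂ʲ equals 0, where F_{ij}(x) = ∂_j( h_{ii}(x)·|x|²/4 ) + 2x^i·h_{ij}(x), and for each j the integration is over the remaining three coordinates ranging over [−1,1]³. -/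
open scoped BigOperators

noncomputable section

/-- The reflection `ℛ = diag(1,−1,−1,−1)`. -/
def Rrefl : Matrix (Fin 4) (Fin 4) ℝ := Matrix.diagonal ![1, -1, -1, -1]

/-- `h⁻(x) = ℛ · h⁺_ξ(ℛ x) · ℛ`. -/
def hminus (ξ11 ξ22 ξ33 ξ12 ξ13 ξ23 : ℝ) (x : Fin 4 → ℝ) : Matrix (Fin 4) (Fin 4) ℝ :=
  Rrefl * hplus ξ11 ξ22 ξ33 ξ12 ξ13 ξ23 (Matrix.mulVec Rrefl x) * Rrefl

/-- `h = h⁺ + h⁻`. -/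
def hfull (ζ11 ζ22 ζ33 ζ12 ζ13 ζ23 ξ11 ξ22 ξ33 ξ12 ξ13 ξ23 : ℝ)
    (x : Fin 4 → ℝ) : Matrix (Fin 4) (Fin 4) ℝ :=
  hplus ζ11 ζ22 ζ33 ζ12 ζ13 ζ23 x + hminus ξ11 ξ22 ξ33 ξ12 ξ13 ξ23 x

open MeasureTheory

/-- Quadratic form with coefficients `c`. -/
def qf (c : Fin 4 → Fin 4 → ℝ) (x : Fin 4 → ℝ) : ℝ := ∑ k, ∑ l, c k l * (x k * x l)

/-- Coefficients of the entry `(i, j)` of `hplus`. -/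
def Cp (a b c d e f : ℝ) (i j k l : Fin 4) : ℝ :=
  -(2 / 3) * (a * (2 * (I1 k i * I1 l j) - I2 k i * I2 l j - I3 k i * I3 l j) +
    b * (2 * (I2 k i * I2 l j) - I1 k i * I1 l j - I3 k i * I3 l j) +
    c * (2 * (I3 k i * I3 l j) - I1 k i * I1 l j - I2 k i * I2 l j) +
    d * (I1 k i * I2 l j + I2 k i * I1 l j) +
    e * (I1 k i * I3 l j + I3 k i * I1 l j) +
    f * (I2 k i * I3 l j + I3 k i * I2 l j))

/-- Diagonal signs of the reflection. -/
def sg : Fin 4 → ℝ := ![1, -1, -1, -1]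

lemma sg_sq (k : Fin 4) : sg k ^ 2 = 1 := by
  fin_cases k <;> simp [sg]

lemma Amat_apply (J K : Matrix (Fin 4) (Fin 4) ℝ) (x : Fin 4 → ℝ) (i j : Fin 4) :
    Amat J K x i j = qf (fun k l => J k i * K l j) x := by
  simp only [Amat, alphaVec, Matrix.vecMulVec_apply, Matrix.mulVec, dotProduct,
    Matrix.transpose_apply, qf, Finset.sum_mul_sum]
  refine Finset.sum_congr rfl fun k _ => Finset.sum_congr rfl fun l _ => ?_
  ring

lemma qf_add (c d : Fin 4 → Fin 4 → ℝ) (x : Fin 4 → ℝ) :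
    qf c x + qf d x = qf (fun k l => c k l + d k l) x := by
  simp only [qf, ← Finset.sum_add_distrib, add_mul]

lemma qf_sub (c d : Fin 4 → Fin 4 → ℝ) (x : Fin 4 → ℝ) :
    qf c x - qf d x = qf (fun k l => c k l - d k l) x := by
  simp only [qf, ← Finset.sum_sub_distrib, sub_mul]

lemma mul_qf (a : ℝ) (c : Fin 4 → Fin 4 → ℝ) (x : Fin 4 → ℝ) :
    a * qf c x = qf (fun k l => a * c k l) x := by
  simp only [qf, Finset.mul_sum, mul_assoc]

lemma hplus_apply (a b c d e f : ℝ) (x : Fin 4 → ℝ) (i j : Fin 4) :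
    hplus a b c d e f x i j = qf (Cp a b c d e f i j) x / (∑ m, x m ^ 2) ^ 3 := by
  have h : ∀ t : ℝ, -(2 / (3 * t)) = (1 / t) * (-(2 / 3)) := by
    intro t; rw [div_mul_eq_div_div]; ring
  simp only [hplus, Matrix.smul_apply, Matrix.add_apply, Matrix.sub_apply, smul_eq_mul,
    Amat_apply, h]
  rw [mul_assoc, one_div_mul_eq_div]
  congr 1
  simp only [qf_add, qf_sub, mul_qf]
  rfl

lemma Rmul (x : Fin 4 → ℝ) (k : Fin 4) : Matrix.mulVec Rrefl x k = sg k * x k := by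
  simp [Rrefl, Matrix.mulVec_diagonal, sg]

lemma hminus_apply (a b c d e f : ℝ) (x : Fin 4 → ℝ) (i j : Fin 4) :
    hminus a b c d e f x i j =
      qf (fun k l => sg i * sg j * sg k * sg l * Cp a b c d e f i j k l) x /
        (∑ m, x m ^ 2) ^ 3 := by
  have h1 : hminus a b c d e f x i j
      = sg i * hplus a b c d e f (Matrix.mulVec Rrefl x) i j * sg j := by
    simp only [hminus, Rrefl, Matrix.mul_diagonal, Matrix.diagonal_mul, sg]
  rw [h1, hplus_apply]
  simp only [Rmul, mul_pow, sg_sq, one_mul]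
  rw [mul_div_assoc', div_mul_eq_mul_div]
  congr 1
  simp only [qf, Finset.mul_sum, Finset.sum_mul]
  refine Finset.sum_congr rfl fun k _ => Finset.sum_congr rfl fun l _ => ?_
  rw [Rmul, Rmul]
  ring

/-- Coefficients of `hfull`. -/
def Cf (a b c d e f a' b' c' d' e' f' : ℝ) (i j k l : Fin 4) : ℝ :=
  Cp a b c d e f i j k l + sg i * sg j * sg k * sg l * Cp a' b' c' d' e' f' i j k l

lemma hfull_apply (a b c d e f a' b' c' d' e' f' : ℝ) (x : Fin 4 → ℝ) (i j : Fin 4) :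
    hfull a b c d e f a' b' c' d' e' f' x i j =
      qf (Cf a b c d e f a' b' c' d' e' f' i j) x / (∑ m, x m ^ 2) ^ 3 := by
  simp only [hfull, Matrix.add_apply, hplus_apply, hminus_apply, ← add_div, qf_add]
  rfl

lemma I3_eq : I3 = !![0, 0, 0, -1; 0, 0, -1, 0; 0, 1, 0, 0; 1, 0, 0, 0] := by
  ext i j
  fin_cases i <;> fin_cases j <;> simp [I3, I1, I2, Matrix.mul_apply, Fin.sum_univ_four]

lemma Cp_ii (a b c d e f : ℝ) (i : Fin 4) : Cp a b c d e f i i i i = 0 := by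
  fin_cases i <;> simp [Cp, I3_eq, I1, I2]

lemma Cp_tr (a b c d e f : ℝ) (i : Fin 4) : ∑ k, Cp a b c d e f i i k k = 0 := by
  fin_cases i <;> simp [Cp, I3_eq, I1, I2, Fin.sum_univ_four] <;> ring

lemma Cp_ij (a b c d e f : ℝ) (i j : Fin 4) (h : j ≠ i) :
    Cp a b c d e f i j i j + Cp a b c d e f i j j i = - Cp a b c d e f i i j j := by
  fin_cases i <;> fin_cases j <;> first | exact absurd rfl h | (simp [Cp, I3_eq, I1, I2]; done) |
    (simp [Cp, I3_eq, I1, I2]; ring)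

lemma sgsg (i : Fin 4) : sg i * sg i = 1 := by rw [← sq, sg_sq]

section
variable (a b c d e f a' b' c' d' e' f' : ℝ)

lemma Cf_ii (i : Fin 4) : Cf a b c d e f a' b' c' d' e' f' i i i i = 0 := by
  simp [Cf, Cp_ii]

lemma Cf_diag (i k : Fin 4) : Cf a b c d e f a' b' c' d' e' f' i i k k =
    Cp a b c d e f i i k k + Cp a' b' c' d' e' f' i i k k := by
  simp only [Cf, sgsg, one_mul]

lemma Cf_tr (i : Fin 4) : ∑ k, Cf a b c d e f a' b' c' d' e' f' i i k k = 0 := by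
  simp only [Cf_diag, Finset.sum_add_distrib, Cp_tr, add_zero]

lemma Cf_ij (i j : Fin 4) (h : j ≠ i) :
    Cf a b c d e f a' b' c' d' e' f' i j i j + Cf a b c d e f a' b' c' d' e' f' i j j i
      = - Cf a b c d e f a' b' c' d' e' f' i i j j := by
  have h1 := Cp_ij a b c d e f i j h
  have h2 := Cp_ij a' b' c' d' e' f' i j h
  have e1 : sg i * sg j * sg i * sg j = 1 := by
    linear_combination (sg j * sg j) * sgsg i + sgsg j
  have e2 : sg i * sg j * sg j * sg i = 1 := by
    linear_combination (sg j * sg j) * sgsg i + sgsg j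
  rw [Cf_diag]
  simp only [Cf, e1, e2, one_mul]
  linarith
end

lemma pd_formula (c : Fin 4 → Fin 4 → ℝ) (j : Fin 4) (x : Fin 4 → ℝ)
    (hx : (∑ m, x m ^ 2) ≠ 0) :
    pd j (fun z => qf c z / (∑ m, z m ^ 2) ^ 3 * (∑ m, z m ^ 2) / 4) x =
      ((∑ l, (c j l + c l j) * x l) / (∑ m, x m ^ 2) ^ 2
        - 4 * x j * qf c x / (∑ m, x m ^ 2) ^ 3) / 4 := by
  have e : ∀ k, HasFDerivAt (fun z : Fin 4 → ℝ => z k) (ContinuousLinearMap.proj k : (Fin 4 → ℝ) →L[ℝ] ℝ) x :=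
    fun k => hasFDerivAt_apply k x
  have hS : HasFDerivAt (fun z : Fin 4 → ℝ => ∑ m, z m ^ 2) _ x :=
    HasFDerivAt.fun_sum (u := Finset.univ) fun m _ => (e m).pow 2
  have hq : HasFDerivAt (fun z : Fin 4 → ℝ => ∑ k, ∑ l, c k l * (z k * z l)) _ x :=
    HasFDerivAt.fun_sum (u := Finset.univ) fun k _ =>
      HasFDerivAt.fun_sum (u := Finset.univ) fun l _ => ((e k).mul (e l)).const_mul (c k l)
  have hf : (fun z : Fin 4 → ℝ => qf c z / (∑ m, z m ^ 2) ^ 3 * (∑ m, z m ^ 2) / 4)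
      = fun z => (∑ k, ∑ l, c k l * (z k * z l)) / (∑ m, z m ^ 2) ^ 2 * (1 / 4) := by
    funext z
    simp only [qf]
    by_cases h : (∑ m, z m ^ 2) = 0
    · simp [h]
    · field_simp
  have hinv := (hasDerivAt_inv (pow_ne_zero 2 hx)).comp_hasFDerivAt x (hS.pow 2)
  have hd : HasFDerivAt (fun z : Fin 4 → ℝ =>
      (∑ k, ∑ l, c k l * (z k * z l)) / (∑ m, z m ^ 2) ^ 2 * (1 / 4)) _ x :=
    (hq.mul hinv).mul_const (1 / 4 : ℝ)
  have s1 : (∑ k, ∑ l, c k l * (x k * (Pi.single j (1 : ℝ) : Fin 4 → ℝ) l + x l * (Pi.single j (1:ℝ) : Fin 4 → ℝ) k))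
      = ∑ l, (c j l + c l j) * x l := by
    simp only [mul_add, Finset.sum_add_distrib, add_mul, Pi.single_apply, mul_ite, mul_one, mul_zero,
      Finset.sum_ite_eq', Finset.mem_univ, if_true]
    rw [add_comm]
    congr 1
    rw [Finset.sum_comm]
    simp
  have s2 : (∑ m, 2 * x m * (Pi.single j (1 : ℝ) : Fin 4 → ℝ) m) = 2 * x j := by
    simp [Pi.single_apply]
  rw [pd, hf, hd.fderiv]
  simp only [ContinuousLinearMap.smul_apply, ContinuousLinearMap.add_apply,
    ContinuousLinearMap.sum_apply, ContinuousLinearMap.proj_apply, smul_eq_mul, nsmul_eq_mul,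
    Function.comp, Nat.cast_ofNat, Nat.add_one_sub_one, pow_one, s1, s2]
  unfold qf
  field_simp
  ring

abbrev cube : Set (Fin 3 → ℝ) := Set.Icc (fun _ : Fin 3 => (-1 : ℝ)) (fun _ => 1)

/-- The squared radius on a face. -/
def rho (y : Fin 3 → ℝ) : ℝ := 1 + ∑ m, y m ^ 2

lemma rho_pos (y : Fin 3 → ℝ) : 0 < rho y := by
  have : 0 ≤ ∑ m, y m ^ 2 := Finset.sum_nonneg fun m _ => sq_nonneg _
  unfold rho; linarith

lemma rho_cont : Continuous rho := by unfold rho; fun_prop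

def KK (n : ℕ) : ℝ := ∫ y in cube, 1 / rho y ^ n
def mom (k l : Fin 3) : ℝ := ∫ y in cube, y k * y l / rho y ^ 3

lemma int_aux {g : (Fin 3 → ℝ) → ℝ} (hg : Continuous g) (n : ℕ) :
    IntegrableOn (fun y => g y / rho y ^ n) cube := by
  apply Continuous.integrableOn_Icc
  exact hg.div (rho_cont.pow n) fun y => pow_ne_zero n (rho_pos y).ne'

lemma mom_perm (σ : Equiv.Perm (Fin 3)) (k l : Fin 3) : mom (σ k) (σ l) = mom k l := by
  have mp := volume_measurePreserving_piCongrLeft (fun _ : Fin 3 => ℝ) σ.symm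
  have := mp.setIntegral_preimage_emb (MeasurableEquiv.measurableEmbedding _)
    (fun y => y k * y l / rho y ^ 3) cube
  have ev : ∀ (y : Fin 3 → ℝ) k,
      (MeasurableEquiv.piCongrLeft (fun _ : Fin 3 => ℝ) σ.symm) y k = y (σ k) := by
    intro y k
    have := Equiv.piCongrLeft_apply_apply (fun _ : Fin 3 => ℝ) σ.symm y (σ k)
    rw [MeasurableEquiv.coe_piCongrLeft]
    simpa using this
  have pre : (MeasurableEquiv.piCongrLeft (fun _ : Fin 3 => ℝ) σ.symm) ⁻¹' cube = cube := by
    ext y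
    simp only [cube, Set.mem_preimage, Set.mem_Icc, Pi.le_def, ev]
    exact and_congr ⟨fun h m => by simpa using h (σ.symm m), fun h m => h _⟩
      ⟨fun h m => by simpa using h (σ.symm m), fun h m => h _⟩
  rw [pre] at this
  unfold mom
  rw [← this]
  refine setIntegral_congr_fun measurableSet_Icc fun y _ => ?_
  have hr : rho ((MeasurableEquiv.piCongrLeft (fun _ : Fin 3 => ℝ) σ.symm) y) = rho y := by
    simp only [rho, ev]
    rw [Equiv.sum_comp σ (fun m => y m ^ 2)]
  simp only [hr, ev]

lemma mom_diag (k : Fin 3) : mom k k = mom 0 0 := by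
  have := mom_perm (Equiv.swap 0 k) 0 0
  simpa using this

lemma mom_off (k l : Fin 3) (h : k ≠ l) : mom k l = 0 := by
  have mp : MeasurePreserving (fun (y : Fin 3 → ℝ) m => if m = k then - y m else y m) volume volume := by
    apply volume_preserving_pi (f := fun m t => if m = k then -t else t)
    intro m
    by_cases hm : m = k
    · simpa [hm] using Measure.measurePreserving_neg (volume : Measure ℝ)
    · simp only [hm, if_false]; exact MeasurePreserving.id (volume : Measure ℝ)
  have inv : Function.Involutive
      (fun (y : Fin 3 → ℝ) m => if m = k then - y m else y m) := by
    intro y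
    funext m
    by_cases hm : m = k <;> simp [hm]
  have := mp.setIntegral_preimage_emb
    (MeasurableEquiv.ofInvolutive _ inv mp.measurable).measurableEmbedding
    (fun y => y k * y l / rho y ^ 3) cube
  have pre : (fun (y : Fin 3 → ℝ) m => if m = k then - y m else y m) ⁻¹' cube = cube := by
    ext y
    simp only [cube, Set.mem_preimage, Set.mem_Icc, Pi.le_def, ← forall_and]
    refine forall_congr' fun m => ?_
    by_cases hm : m = k
    · simp only [hm, if_true]
      constructor <;> rintro ⟨h1, h2⟩ <;> constructor <;> linarith
    · simp only [hm, if_false]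
  rw [pre] at this
  have h2 : ∀ y : Fin 3 → ℝ, rho (fun m => if m = k then - y m else y m) = rho y := by
    intro y
    simp only [rho]
    congr 1
    refine Finset.sum_congr rfl fun m _ => ?_
    by_cases hm : m = k <;> simp [hm]
  simp only [h2, if_true, if_neg h.symm, neg_mul, neg_div, integral_neg] at this
  unfold mom
  linarith

lemma face_int (A B : ℝ) (e : Fin 3 → Fin 3 → ℝ) :
    ∫ y in cube, (A * (1 / rho y ^ 2) + B * (1 / rho y ^ 3) +
      ∑ k, ∑ l, e k l * (y k * y l / rho y ^ 3)) =
    A * KK 2 + B * KK 3 + (∑ k, e k k) * mom 0 0 := by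
  have i2 : ∀ n, IntegrableOn (fun y => 1 / rho y ^ n) cube := fun n => int_aux continuous_const n
  have im : ∀ k l, IntegrableOn (fun y => y k * y l / rho y ^ 3) cube :=
    fun k l => int_aux (by fun_prop) 3
  have is' : ∀ k, IntegrableOn (fun y => ∑ l, e k l * (y k * y l / rho y ^ 3)) cube :=
    fun k => integrable_finsetSum _ fun l _ => (im k l).const_mul _
  have i23 : IntegrableOn (fun y => A * (1 / rho y ^ 2) + B * (1 / rho y ^ 3)) cube :=
    ((i2 2).const_mul A).add ((i2 3).const_mul B)
  rw [integral_add i23 (integrable_finsetSum _ fun k _ => is' k),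
    integral_add ((i2 2).const_mul A) ((i2 3).const_mul B), integral_const_mul, integral_const_mul,
    integral_finsetSum _ fun k _ => is' k]
  congr 1
  rw [Finset.sum_mul]
  refine Finset.sum_congr rfl fun k _ => ?_
  rw [integral_finsetSum _ fun l _ => (im k l).const_mul _, Finset.sum_eq_single k]
  · rw [integral_const_mul]
    exact congrArg _ (mom_diag k)
  · intro l _ hl
    rw [integral_const_mul]
    have := mom_off k l hl.symm
    unfold mom at this
    rw [this, mul_zero]
  · simp

lemma sum_sq_ins (j : Fin 4) (s : ℝ) (hs : s ^ 2 = 1) (y : Fin 3 → ℝ) :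
    ∑ m, (j.insertNth s y : Fin 4 → ℝ) m ^ 2 = rho y := by
  rw [Fin.sum_univ_succAbove _ j]
  simp [rho, hs]

lemma qf_ins (c : Fin 4 → Fin 4 → ℝ) (j : Fin 4) (s : ℝ) (hs : s ^ 2 = 1) (y : Fin 3 → ℝ) :
    qf c (j.insertNth s y : Fin 4 → ℝ) = c j j + s * ∑ k, (c j (j.succAbove k) + c (j.succAbove k) j) * y k +
      ∑ k, ∑ l, c (j.succAbove k) (j.succAbove l) * (y k * y l) := by
  unfold qf
  rw [Fin.sum_univ_succAbove _ j]
  simp only [Fin.sum_univ_succAbove _ j, Fin.insertNth_apply_same, Fin.insertNth_apply_succAbove,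
    Finset.sum_add_distrib, Finset.mul_sum, add_mul, mul_add]
  rw [show s * s = 1 by rw [← sq, hs]]
  have h1 : ∀ k, c j (j.succAbove k) * (s * y k) = s * (c j (j.succAbove k) * y k) := fun k => by ring
  have h2 : ∀ k, c (j.succAbove k) j * (y k * s) = s * (c (j.succAbove k) j * y k) := fun k => by ring
  simp only [h1, h2]
  ring

/-- The integrand on a face. -/
def Fc (i j : Fin 4) (c d : Fin 4 → Fin 4 → ℝ) (x : Fin 4 → ℝ) : ℝ :=
  pd j (fun z => qf c z / (∑ m, z m ^ 2) ^ 3 * (∑ m, z m ^ 2) / 4) x +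
    2 * x i * (qf d x / (∑ m, x m ^ 2) ^ 3)

lemma Fc_ins (i j : Fin 4) (c d : Fin 4 → Fin 4 → ℝ) (s : ℝ) (hs : s ^ 2 = 1) (y : Fin 3 → ℝ) :
    Fc i j c d (j.insertNth s y) =
      ((2 * c j j * s + ∑ k, (c j (j.succAbove k) + c (j.succAbove k) j) * y k) / rho y ^ 2
        - 4 * s * qf c (j.insertNth s y) / rho y ^ 3) / 4
      + 2 * (j.insertNth s y : Fin 4 → ℝ) i * (qf d (j.insertNth s y) / rho y ^ 3) := by
  unfold Fc
  rw [pd_formula _ _ _ (by rw [sum_sq_ins j s hs]; exact (rho_pos y).ne'), sum_sq_ins j s hs,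
    Fin.sum_univ_succAbove _ j]
  simp only [Fin.insertNth_apply_same, Fin.insertNth_apply_succAbove]
  ring

lemma face_same (i : Fin 4) (c : Fin 4 → Fin 4 → ℝ) (hii : c i i = 0) (tr : ∑ k, c k k = 0) :
    ∫ y in cube, (Fc i i c c (i.insertNth 1 y) - Fc i i c c (i.insertNth (-1) y)) = 0 := by
  have := face_int 0 0 (fun k l => 2 * c (i.succAbove k) (i.succAbove l))
  rw [Fin.sum_univ_succAbove _ i, hii, zero_add] at tr
  rw [← Finset.mul_sum, tr] at this
  simp only [zero_mul, mul_zero, add_zero, zero_add] at this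
  rw [← this]
  congr 1
  funext y
  rw [Fc_ins _ _ _ _ _ (by norm_num), Fc_ins _ _ _ _ _ (by norm_num), qf_ins _ _ _ (by norm_num),
    qf_ins _ _ _ (by norm_num)]
  simp only [Fin.insertNth_apply_same, hii, mul_div_assoc', mul_assoc, ← Finset.mul_sum,
    ← Finset.sum_div]
  ring

lemma face_diff (i j : Fin 4) (hij : j ≠ i) (c d : Fin 4 → Fin 4 → ℝ) (tr : ∑ k, c k k = 0)
    (hd : d i j + d j i = - c j j) :
    ∫ y in cube, (Fc i j c d (j.insertNth 1 y) - Fc i j c d (j.insertNth (-1) y)) =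
      c j j * (KK 2 - 2 * KK 3 - 2 * mom 0 0) := by
  obtain ⟨k0, rfl⟩ := Fin.exists_succAbove_eq hij.symm
  have := face_int (c j j) (-2 * c j j) (fun k l => -2 * c (j.succAbove k) (j.succAbove l) +
    if k = k0 then 4 * (d j (j.succAbove l) + d (j.succAbove l) j) else 0)
  rw [Fin.sum_univ_succAbove _ j] at tr
  have e : ∑ k, (-2 * c (j.succAbove k) (j.succAbove k) +
    if k = k0 then 4 * (d j (j.succAbove k) + d (j.succAbove k) j) else 0) = -2 * c j j := by
    rw [Finset.sum_add_distrib, ← Finset.mul_sum]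
    simp only [Finset.sum_ite_eq', Finset.mem_univ, if_true]
    linarith
  rw [e] at this
  rw [show c j j * (KK 2 - 2 * KK 3 - 2 * mom 0 0) = c j j * KK 2 + -2 * c j j * KK 3 + -2 * c j j * mom 0 0 by ring, ← this]
  congr 1
  funext y
  rw [Fc_ins _ _ _ _ _ (by norm_num), Fc_ins _ _ _ _ _ (by norm_num)]
  simp only [qf_ins _ j (1:ℝ) (by norm_num), qf_ins _ j (-1:ℝ) (by norm_num)]
  simp only [Fin.insertNth_apply_succAbove, add_mul, Finset.sum_add_distrib, ite_mul, zero_mul]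
  have e2 : ∑ k, ∑ l, (if k = k0 then 4 * (d j (j.succAbove l) + d (j.succAbove l) j) * (y k * y l / rho y ^ 3) else 0)
     = 4 * y k0 * (∑ l, d j (j.succAbove l) * y l + ∑ l, d (j.succAbove l) j * y l) / rho y ^ 3 := by
    rw [Finset.sum_eq_single k0]
    · simp only [if_true, ← Finset.sum_add_distrib, Finset.mul_sum, Finset.sum_div]
      refine Finset.sum_congr rfl fun l _ => ?_
      ring
    · intro k _ hk; simp [hk]
    · simp
  simp only [mul_add, add_mul, ite_mul, zero_mul] at e2 ⊢
  rw [e2]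
  simp only [mul_div_assoc', mul_assoc, ← Finset.mul_sum, ← Finset.sum_div]
  ring

/-- For each `i`, the cube-boundary integral of
`F_{ij}(x) = ∂_j(h_{ii}(x)·|x|²/4) + 2xⁱ·h_{ij}(x)` vanishes. -/
theorem cube_boundary_integral_diag_vanishes
    (ζ11 ζ22 ζ33 ζ12 ζ13 ζ23 ξ11 ξ22 ξ33 ξ12 ξ13 ξ23 : ℝ) (i : Fin 4) :
    ∑ j : Fin 4,
      (∫ y in Set.Icc (fun _ : Fin 3 => (-1 : ℝ)) (fun _ => 1),
        ((fun x : Fin 4 → ℝ =>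
            pd j (fun z => hfull ζ11 ζ22 ζ33 ζ12 ζ13 ζ23 ξ11 ξ22 ξ33 ξ12 ξ13 ξ23 z i i *
              (∑ m, z m ^ 2) / 4) x +
            2 * x i * hfull ζ11 ζ22 ζ33 ζ12 ζ13 ζ23 ξ11 ξ22 ξ33 ξ12 ξ13 ξ23 x i j)
          (j.insertNth 1 y) -
         (fun x : Fin 4 → ℝ =>
            pd j (fun z => hfull ζ11 ζ22 ζ33 ζ12 ζ13 ζ23 ξ11 ξ22 ξ33 ξ12 ξ13 ξ23 z i i *
              (∑ m, z m ^ 2) / 4) x +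
            2 * x i * hfull ζ11 ζ22 ζ33 ζ12 ζ13 ζ23 ξ11 ξ22 ξ33 ξ12 ξ13 ξ23 x i j)
          (j.insertNth (-1) y)))
      = 0 := by
  have hF : ∀ j, (fun x : Fin 4 → ℝ =>
            pd j (fun z => hfull ζ11 ζ22 ζ33 ζ12 ζ13 ζ23 ξ11 ξ22 ξ33 ξ12 ξ13 ξ23 z i i *
              (∑ m, z m ^ 2) / 4) x +
            2 * x i * hfull ζ11 ζ22 ζ33 ζ12 ζ13 ζ23 ξ11 ξ22 ξ33 ξ12 ξ13 ξ23 x i j)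
      = Fc i j (Cf ζ11 ζ22 ζ33 ζ12 ζ13 ζ23 ξ11 ξ22 ξ33 ξ12 ξ13 ξ23 i i)
          (Cf ζ11 ζ22 ζ33 ζ12 ζ13 ζ23 ξ11 ξ22 ξ33 ξ12 ξ13 ξ23 i j) := by
    intro j
    funext x
    simp only [hfull_apply, Fc]
  have hii := Cf_ii ζ11 ζ22 ζ33 ζ12 ζ13 ζ23 ξ11 ξ22 ξ33 ξ12 ξ13 ξ23 i
  have htr := Cf_tr ζ11 ζ22 ζ33 ζ12 ζ13 ζ23 ξ11 ξ22 ξ33 ξ12 ξ13 ξ23 i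
  have hij := Cf_ij ζ11 ζ22 ζ33 ζ12 ζ13 ζ23 ξ11 ξ22 ξ33 ξ12 ξ13 ξ23 i
  have key := fun j => (show (∫ y in cube, (Fc i j (Cf ζ11 ζ22 ζ33 ζ12 ζ13 ζ23 ξ11 ξ22 ξ33 ξ12 ξ13 ξ23 i i)
          (Cf ζ11 ζ22 ζ33 ζ12 ζ13 ζ23 ξ11 ξ22 ξ33 ξ12 ξ13 ξ23 i j) (j.insertNth 1 y)
        - Fc i j (Cf ζ11 ζ22 ζ33 ζ12 ζ13 ζ23 ξ11 ξ22 ξ33 ξ12 ξ13 ξ23 i i)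
          (Cf ζ11 ζ22 ζ33 ζ12 ζ13 ζ23 ξ11 ξ22 ξ33 ξ12 ξ13 ξ23 i j) (j.insertNth (-1) y)))
      = Cf ζ11 ζ22 ζ33 ζ12 ζ13 ζ23 ξ11 ξ22 ξ33 ξ12 ξ13 ξ23 i i j j *
        (KK 2 - 2 * KK 3 - 2 * mom 0 0) by
    by_cases h : j = i
    · subst h
      rw [hii, zero_mul]
      exact face_same _ _ hii htr
    · exact face_diff _ _ h _ _ htr (hij j h))
  refine (Finset.sum_congr rfl fun j _ => ?_).trans (b := ∑ j,
    Cf ζ11 ζ22 ζ33 ζ12 ζ13 ζ23 ξ11 ξ22 ξ33 ξ12 ξ13 ξ23 i i j j *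
        (KK 2 - 2 * KK 3 - 2 * mom 0 0)) ?_
  · have := key j
    rw [← hF j] at this
    exact this
  rw [← Finset.sum_mul, htr, zero_mul]
end
end
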